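/- arXiv:2401.17204 — 2 statements merged into one kernel-verified Lean document; each statement's English description precedes it below -/
import Mathlib

section
/- For every U-tree T, the family of points {(e_i, e_j) : (i,j) ∈ T} ⊆ ℝ^{a+1} × ℝ^{b+1} is affinely independent; hence its convex hull is a simplex of dimension a + b. -/
/-- A sequence `u 0, …, u a` of positive integers is unimodular if it increases
up to some index `k ≤ a` and decreases afterwards. -/
def IsUnimodular (a : ℕ) (u : ℕ → ℕ) : Prop :=
  (∀ i, i ≤ a → 0 < u i) ∧
  ∃ k, k ≤ a ∧ (∀ i j, i ≤ j → j ≤ k → u i ≤ u j) ∧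
    (∀ i j, k ≤ i → i ≤ j → j ≤ a → u j ≤ u i)

/-- The stack set of the sequence `u 0, …, u a`: the point in column `i` and
row `j` (rows increasing downward) belongs to it iff `i ≤ a` and `j < u i`. -/
def stackSet (a : ℕ) (u : ℕ → ℕ) : Set (ℕ × ℕ) :=
  {p | p.1 ≤ a ∧ p.2 < u p.1}

/-- Two points `p, q` are `U`-incompatible if one is strictly southwest or strictly
northeast of the other and the whole rectangle spanned by them lies inside `U`. -/
def Incompat (U : Set (ℕ × ℕ)) (p q : ℕ × ℕ) : Prop :=
  ((p.1 < q.1 ∧ q.2 < p.2) ∨ (q.1 < p.1 ∧ p.2 < q.2)) ∧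
  ∀ k l : ℕ, min p.1 q.1 ≤ k → k ≤ max p.1 q.1 → min p.2 q.2 ≤ l → l ≤ max p.2 q.2 →
    (k, l) ∈ U

/-- `U`-compatibility. -/
def Compat (U : Set (ℕ × ℕ)) (p q : ℕ × ℕ) : Prop := ¬ Incompat U p q

/-- A `U`-tree is a maximal (under inclusion) pairwise `U`-compatible subset of `U`. -/
def IsUTree (U T : Set (ℕ × ℕ)) : Prop :=
  T ⊆ U ∧ T.Pairwise (Compat U) ∧
    ∀ T' : Set (ℕ × ℕ), T' ⊆ U → T'.Pairwise (Compat U) → T ⊆ T' → T' = T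

/-- The vertex `(e_i, e_j)` of `Δ_a × Δ_b ⊆ ℝ^{a+1} × ℝ^{b+1}` associated to the
lattice point `p = (i, j)`. -/
noncomputable def embedPt (a b : ℕ) (p : ℕ × ℕ) :
    (Fin (a + 1) → ℝ) × (Fin (b + 1) → ℝ) :=
  (fun i => if (i : ℕ) = p.1 then 1 else 0, fun j => if (j : ℕ) = p.2 then 1 else 0)

theorem IsUnimodular.lt_of_between {a : ℕ} {u : ℕ → ℕ} (hu : IsUnimodular a u) {i m i' n : ℕ}
    (him : i ≤ m) (hmi : m ≤ i') (ha : i' ≤ a) (hi : n < u i) (hi' : n < u i') : n < u m := by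
  obtain ⟨-, k, -, hinc, hdec⟩ := hu
  rcases le_total m k with h | h
  · exact hi.trans_le (hinc i m him h)
  · exact hi'.trans_le (hdec m i' h hmi ha)

theorem Incompat.symm {U : Set (ℕ × ℕ)} {p q : ℕ × ℕ} (h : Incompat U p q) : Incompat U q p := by
  refine ⟨h.1.symm, fun k l => ?_⟩
  rw [min_comm q.1, max_comm q.1, min_comm q.2, max_comm q.2]
  exact h.2 k l

/-- In a stack set a southwest point `p` and a northeast point `q` of a `U`-tree never have the
southeast corner of their rectangle in `U`. -/
theorem IsUTree.not_southwest {a : ℕ} {u : ℕ → ℕ} (hu : IsUnimodular a u) {T : Set (ℕ × ℕ)}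
    (hT : IsUTree (stackSet a u) T) {p q : ℕ × ℕ} (hp : p ∈ T) (hq : q ∈ T)
    (h1 : p.1 < q.1) (h2 : q.2 < p.2) : u q.1 ≤ p.2 := by
  by_contra! hc
  have hpU := hT.1 hp
  have hqU := hT.1 hq
  refine hT.2.1 hp hq (fun h => by simp [h] at h1) ⟨Or.inl ⟨h1, h2⟩, fun k l hk hk' hl hl' => ?_⟩
  rw [min_eq_left h1.le] at hk
  rw [max_eq_right h1.le] at hk'
  rw [max_eq_left h2.le] at hl'
  exact ⟨hk'.trans hqU.1, hl'.trans_lt (hu.lt_of_between hk hk' hqU.1 hpU.2 hc)⟩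

/-- A point of the stack set outside a `U`-tree is incompatible with a point of the tree. -/
theorem IsUTree.exists_obstruction {a : ℕ} {u : ℕ → ℕ} {T : Set (ℕ × ℕ)}
    (hT : IsUTree (stackSet a u) T) {i j : ℕ} (hi : i ≤ a) (hj : j < u i) (hp : (i, j) ∉ T) :
    (∃ x y, (x, y) ∈ T ∧ x < i ∧ j < y ∧ y < u i) ∨
      (∃ x y, (x, y) ∈ T ∧ i < x ∧ y < j ∧ j < u x) := by
  by_contra! hc
  refine hp ?_
  have key : ∀ q ∈ T, Compat (stackSet a u) (i, j) q := by
    rintro ⟨x, y⟩ hq ⟨h, hrect⟩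
    rcases h with ⟨h1, h2⟩ | ⟨h1, h2⟩
    · have := (hrect x j (by simp) (by simp) (by simp) (by simp)).2
      exact absurd this (not_lt.2 (hc.2 x y hq h1 h2))
    · have := (hrect i y (by simp) (by simp) (by simp) (by simp)).2
      exact absurd this (not_lt.2 (hc.1 x y hq h1 h2))
  have := hT.2.2 (insert (i, j) T) (Set.insert_subset ⟨hi, hj⟩ hT.1)
    (hT.2.1.insert fun q hq _ => ⟨key q hq, fun h => key q hq h.symm⟩) (Set.subset_insert _ _)
  exact this ▸ Set.mem_insert _ _

theorem IsUTree.exists_mem_column {a : ℕ} {u : ℕ → ℕ} (hu : IsUnimodular a u) {T : Set (ℕ × ℕ)}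
    (hT : IsUTree (stackSet a u) T) {i : ℕ} (hi : i ≤ a) : ∃ j, (i, j) ∈ T := by
  classical
  by_contra! hne
  obtain ⟨x₀, y₀, hT₀, hx₀, -, hy₀⟩ :=
    (hT.exists_obstruction hi (hu.1 i hi) (hne 0)).resolve_right (by simp)
  obtain ⟨y, ⟨hy, x, hx, hxy⟩, hmax⟩ : ∃ y, (y < u i ∧ ∃ x, x < i ∧ (x, y) ∈ T) ∧
      ∀ y', (y' < u i ∧ ∃ x, x < i ∧ (x, y') ∈ T) → y' ≤ y :=
    ⟨_, Nat.findGreatest_spec (P := fun y => y < u i ∧ ∃ x, x < i ∧ (x, y) ∈ T)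
      hy₀.le ⟨hy₀, x₀, hx₀, hT₀⟩, fun y' h => Nat.le_findGreatest h.1.le h⟩
  rcases hT.exists_obstruction hi hy (hne y) with ⟨x', y', h, h1, h2, h3⟩ | ⟨x', y', h, h1, h2, h3⟩
  · exact absurd (hmax y' ⟨h3, x', h1, h⟩) (not_le.2 h2)
  · exact absurd (hT.not_southwest hu hxy h (hx.trans h1) h2) (not_le.2 h3)

theorem IsUTree.exists_mem_row {a : ℕ} {u : ℕ → ℕ} (hu : IsUnimodular a u) {T : Set (ℕ × ℕ)}
    (hT : IsUTree (stackSet a u) T) {j : ℕ} (hj : ∃ i, i ≤ a ∧ j < u i) : ∃ i, (i, j) ∈ T := by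
  classical
  by_contra! hne
  obtain ⟨l, ⟨hl, hjl⟩, hmin⟩ : ∃ l, (l ≤ a ∧ j < u l) ∧ ∀ m, (m ≤ a ∧ j < u m) → l ≤ m :=
    ⟨_, Nat.find_spec hj, fun m hm => Nat.find_min' hj hm⟩
  obtain ⟨x₀, y₀, hT₀, -, hy₀, hx₀⟩ : ∃ x y, (x, y) ∈ T ∧ l < x ∧ y < j ∧ j < u x := by
    refine (hT.exists_obstruction hl hjl (hne l)).resolve_left ?_
    rintro ⟨x, y, h, h1, h2, -⟩
    exact absurd (hmin x ⟨(hT.1 h).1, h2.trans (hT.1 h).2⟩) (not_le.2 h1)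
  obtain ⟨x, ⟨hx, y, hy, hxy⟩, hmax⟩ : ∃ x, (j < u x ∧ ∃ y, y < j ∧ (x, y) ∈ T) ∧
      ∀ x', (j < u x' ∧ ∃ y, y < j ∧ (x', y) ∈ T) → x' ≤ x :=
    ⟨_, Nat.findGreatest_spec (P := fun x => j < u x ∧ ∃ y, y < j ∧ (x, y) ∈ T)
      (hT.1 hT₀).1 ⟨hx₀, y₀, hy₀, hT₀⟩,
      fun x' h => Nat.le_findGreatest (by obtain ⟨_, y, _, h⟩ := h; exact (hT.1 h).1) h⟩
  rcases hT.exists_obstruction (hT.1 hxy).1 hx (hne x) with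
    ⟨x', y', h, h1, h2, h3⟩ | ⟨x', y', h, h1, h2, h3⟩
  · exact absurd (hT.not_southwest hu h hxy h1 (hy.trans h2)) (not_le.2 h3)
  · exact absurd (hmax x' ⟨h3, y', h2, h⟩) (not_le.2 h1)

/-- Every row of `U` below the top one shares a column with a higher row in a `U`-tree. -/
theorem IsUTree.exists_mem_row_above {a : ℕ} {u : ℕ → ℕ} (hu : IsUnimodular a u)
    {T : Set (ℕ × ℕ)} (hT : IsUTree (stackSet a u) T) {j : ℕ} (hj0 : 0 < j)
    (hj : ∃ i, i ≤ a ∧ j < u i) : ∃ i y, y < j ∧ (i, j) ∈ T ∧ (i, y) ∈ T := by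
  classical
  have hex := hT.exists_mem_row hu hj
  obtain ⟨i, hij, hmin⟩ : ∃ i, (i, j) ∈ T ∧ ∀ m, (m, j) ∈ T → i ≤ m :=
    ⟨_, Nat.find_spec hex, fun m hm => Nat.find_min' hex hm⟩
  by_contra! hcon
  have hne : ∀ y, y < j → (i, y) ∉ T := fun y hy => hcon i y hy hij
  have hi : i ≤ a := (hT.1 hij).1
  have hji : j < u i := (hT.1 hij).2
  have hlt : ∀ x y, (x, y) ∈ T → x < i → y < u i → y < j := by
    intro x y h hx hy
    by_contra! hle
    rcases hle.eq_or_lt with rfl | h2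
    · exact absurd (hmin x h) (not_le.2 hx)
    · exact absurd (hT.not_southwest hu h hij hx h2) (not_le.2 hy)
  obtain ⟨x₀, y₀, hT₀, hx₀, -, hy₀⟩ :=
    (hT.exists_obstruction hi (hu.1 i hi) (hne 0 hj0)).resolve_right (by simp)
  have hy₀j := hlt x₀ y₀ hT₀ hx₀ hy₀
  obtain ⟨y, ⟨hy, x, hx, hxy⟩, hmax⟩ : ∃ y, (y < j ∧ ∃ x, x < i ∧ (x, y) ∈ T) ∧
      ∀ y', (y' < j ∧ ∃ x, x < i ∧ (x, y') ∈ T) → y' ≤ y :=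
    ⟨_, Nat.findGreatest_spec (P := fun y => y < j ∧ ∃ x, x < i ∧ (x, y) ∈ T)
      hy₀j.le ⟨hy₀j, x₀, hx₀, hT₀⟩, fun y' h => Nat.le_findGreatest h.1.le h⟩
  rcases hT.exists_obstruction hi (hy.trans hji) (hne y hy) with
    ⟨x', y', h, h1, h2, h3⟩ | ⟨x', y', h, h1, h2, h3⟩
  · exact absurd (hmax y' ⟨hlt x' y' h h1 h3, x', h1, h⟩) (not_le.2 h2)
  · exact absurd (hT.not_southwest hu hxy h (hx.trans h1) h2) (not_le.2 h3)

theorem exists_ne_of_sum_fiber_eq_zero {α β : Type*} [DecidableEq β] {s : Finset α} {w : α → ℝ}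
    {f : α → β} {p : α} (hp : p ∈ s) (hw : w p ≠ 0)
    (h : ∑ q ∈ s, w q * (if f p = f q then 1 else 0) = 0) :
    ∃ q ∈ s, q ≠ p ∧ f q = f p ∧ w q ≠ 0 := by
  by_contra! hc
  rw [Finset.sum_eq_single_of_mem p hp] at h
  · simp [hw] at h
  · intro q hq hqp
    by_cases hf : f q = f p
    · simp [hc q hq hqp hf]
    · simp [Ne.symm hf]

theorem IsUTree.affineIndependent_embedPt {a b : ℕ} {u : ℕ → ℕ} (hu : IsUnimodular a u)
    (hub : ∀ i, i ≤ a → u i ≤ b + 1) {T : Set (ℕ × ℕ)} (hT : IsUTree (stackSet a u) T) :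
    AffineIndependent ℝ (fun p : T => embedPt a b (p : ℕ × ℕ)) := by
  classical
  rw [affineIndependent_iff]
  intro s w _ hsum p₀ hp₀
  by_contra hw₀
  have hcol : ∀ p ∈ s, w p ≠ 0 → ∃ q ∈ s, q ≠ p ∧ q.1.1 = p.1.1 ∧ w q ≠ 0 := by
    intro p hp hw
    refine exists_ne_of_sum_fiber_eq_zero (f := fun p : T => p.1.1) hp hw ?_
    have := congrFun (congrArg Prod.fst hsum) ⟨p.1.1, Nat.lt_succ_of_le (hT.1 p.2).1⟩
    simpa [Prod.fst_sum, Finset.sum_apply, embedPt] using this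
  have hrow : ∀ p ∈ s, w p ≠ 0 → ∃ q ∈ s, q ≠ p ∧ q.1.2 = p.1.2 ∧ w q ≠ 0 := by
    intro p hp hw
    refine exists_ne_of_sum_fiber_eq_zero (f := fun p : T => p.1.2) hp hw ?_
    have := congrFun (congrArg Prod.snd hsum)
      ⟨p.1.2, (hT.1 p.2).2.trans_le (hub _ (hT.1 p.2).1)⟩
    simpa [Prod.snd_sum, Finset.sum_apply, embedPt] using this
  obtain ⟨p, hp, hmax⟩ := (s.filter fun p => w p ≠ 0).exists_max_image (fun p => p.1.2)
    ⟨p₀, by simp [hp₀, hw₀]⟩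
  simp only [Finset.mem_filter] at hp hmax
  -- A point `q` of the bottom row of the support with another such point `p` on its left.
  have main : ∀ p q : T, q ∈ s → w q ≠ 0 → p.1.1 < q.1.1 → q.1.2 = p.1.2 →
      (∀ x : T, x ∈ s ∧ w x ≠ 0 → x.1.2 ≤ p.1.2) → False := by
    intro p q hq hwq hlt hpq hmax
    obtain ⟨r, hr, hrq, hr1, hwr⟩ := hcol q hq hwq
    have hr2 : r.1.2 < p.1.2 := by
      refine lt_of_le_of_ne (hmax r ⟨hr, hwr⟩) fun h => hrq ?_
      exact Subtype.ext (Prod.ext hr1 (h.trans hpq.symm))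
    have := hT.not_southwest hu p.2 r.2 (hr1 ▸ hlt) hr2
    rw [hr1, ← hpq] at this
    exact absurd (hT.1 q.2).2 (not_lt.2 this)
  obtain ⟨q, hq, hqp, hq2, hwq⟩ := hrow p hp.1 hp.2
  rcases lt_trichotomy p.1.1 q.1.1 with h | h | h
  · exact main p q hq hwq h hq2 hmax
  · exact hqp (Subtype.ext (Prod.ext h.symm hq2))
  · exact main q p hp.1 hp.2 h hq2.symm (hq2 ▸ hmax)

theorem sum_smul_single_sub_single {n : ℕ} (v : Fin (n + 1) → ℝ) (hv : ∑ i, v i = 0) :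
    ∑ i, v i • (Pi.single i 1 - Pi.single 0 1 : Fin (n + 1) → ℝ) = v := by
  simp only [smul_sub, Finset.sum_sub_distrib, ← Finset.sum_smul, hv, zero_smul, sub_zero]
  ext j
  simp [Finset.sum_apply, Pi.single_apply]

theorem embedPt_eq_single {a b : ℕ} (i : Fin (a + 1)) (j : Fin (b + 1)) :
    embedPt a b ((i : ℕ), (j : ℕ)) = (Pi.single i 1, Pi.single j 1) := by
  ext k <;> simp [embedPt, Pi.single_apply, Fin.ext_iff]

/-- The pair of coordinate sums on `ℝ^{a+1} × ℝ^{b+1}`. -/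
noncomputable def coordSums (a b : ℕ) :
    ((Fin (a + 1) → ℝ) × (Fin (b + 1) → ℝ)) →ₗ[ℝ] ℝ × ℝ :=
  LinearMap.prodMap (∑ i, LinearMap.proj i) (∑ j, LinearMap.proj j)

theorem coordSums_apply (a b : ℕ) (v : (Fin (a + 1) → ℝ) × (Fin (b + 1) → ℝ)) :
    coordSums a b v = (∑ i, v.1 i, ∑ j, v.2 j) := by
  simp [coordSums]

theorem finrank_ker_coordSums (a b : ℕ) :
    Module.finrank ℝ (LinearMap.ker (coordSums a b)) = a + b := by
  have hsurj : Function.Surjective (coordSums a b) := by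
    rintro ⟨x, y⟩
    exact ⟨(Pi.single 0 x, Pi.single 0 y), by simp [coordSums_apply]⟩
  have h := LinearMap.finrank_range_add_finrank_ker (coordSums a b)
  rw [LinearMap.range_eq_top.2 hsurj, finrank_top] at h
  simp only [Module.finrank_prod, Module.finrank_self, Module.finrank_fin_fun] at h
  omega

theorem IsUTree.vectorSpan_embedPt {a b : ℕ} {u : ℕ → ℕ} (hu : IsUnimodular a u)
    (hub : ∀ i, i ≤ a → u i ≤ b + 1) (hmax : ∃ i, i ≤ a ∧ u i = b + 1) {T : Set (ℕ × ℕ)}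
    (hT : IsUTree (stackSet a u) T) :
    vectorSpan ℝ (embedPt a b '' T) = LinearMap.ker (coordSums a b) := by
  have hrow : ∀ j : Fin (b + 1), ∃ i, i ≤ a ∧ (j : ℕ) < u i := by
    obtain ⟨i, hi, hui⟩ := hmax
    exact fun j => ⟨i, hi, j.2.trans_eq hui.symm⟩
  have hlift : ∀ p ∈ T, ∃ (i : Fin (a + 1)) (j : Fin (b + 1)), p = ((i : ℕ), (j : ℕ)) :=
    fun p hp => ⟨⟨p.1, Nat.lt_succ_of_le (hT.1 hp).1⟩,
      ⟨p.2, (hT.1 hp).2.trans_le (hub _ (hT.1 hp).1)⟩, rfl⟩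
  have hmem : ∀ (i i' : Fin (a + 1)) (j j' : Fin (b + 1)), ((i : ℕ), (j : ℕ)) ∈ T →
      ((i' : ℕ), (j' : ℕ)) ∈ T →
      ((Pi.single i 1 - Pi.single i' 1, Pi.single j 1 - Pi.single j' 1) :
        (Fin (a + 1) → ℝ) × (Fin (b + 1) → ℝ)) ∈ vectorSpan ℝ (embedPt a b '' T) := by
    intro i i' j j' h h'
    have := vsub_mem_vectorSpan ℝ (Set.mem_image_of_mem (embedPt a b) h)
      (Set.mem_image_of_mem (embedPt a b) h')
    rwa [embedPt_eq_single, embedPt_eq_single, vsub_eq_sub, Prod.mk_sub_mk] at this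
  apply le_antisymm
  · rw [vectorSpan_def, Submodule.span_le]
    rintro _ ⟨_, ⟨p, hp, rfl⟩, _, ⟨q, hq, rfl⟩, rfl⟩
    obtain ⟨i, j, rfl⟩ := hlift p hp
    obtain ⟨i', j', rfl⟩ := hlift q hq
    simp [embedPt_eq_single, coordSums_apply]
  · have hsnd : ∀ (n : ℕ) (hn : n < b + 1),
        ((0, Pi.single ⟨n, hn⟩ 1 - Pi.single 0 1) :
          (Fin (a + 1) → ℝ) × (Fin (b + 1) → ℝ)) ∈ vectorSpan ℝ (embedPt a b '' T) := by
      intro n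
      induction n using Nat.strong_induction_on with
      | _ n ih =>
        intro hn
        rcases Nat.eq_zero_or_pos n with rfl | hpos
        · simp [Prod.mk_zero_zero, zero_mem]
        obtain ⟨i, y, hy, hin, hiy⟩ := hT.exists_mem_row_above hu hpos (hrow ⟨n, hn⟩)
        have hi : i < a + 1 := Nat.lt_succ_of_le (hT.1 hin).1
        have := add_mem (hmem ⟨i, hi⟩ ⟨i, hi⟩ ⟨n, hn⟩ ⟨y, hy.trans hn⟩ hin hiy)
          (ih y hy (hy.trans hn))
        simpa using this
    have hfst : ∀ i : Fin (a + 1), ((Pi.single i 1 - Pi.single 0 1, 0) :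
        (Fin (a + 1) → ℝ) × (Fin (b + 1) → ℝ)) ∈ vectorSpan ℝ (embedPt a b '' T) := by
      intro i
      obtain ⟨j, hj⟩ := hT.exists_mem_column hu (Nat.le_of_lt_succ i.2)
      obtain ⟨j₀, hj₀⟩ := hT.exists_mem_column hu (Nat.zero_le a)
      have hjb : j < b + 1 := (hT.1 hj).2.trans_le (hub _ (hT.1 hj).1)
      have hjb₀ : j₀ < b + 1 := (hT.1 hj₀).2.trans_le (hub _ (hT.1 hj₀).1)
      have := sub_mem (hmem i 0 ⟨j, hjb⟩ ⟨j₀, hjb₀⟩ hj hj₀)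
        (sub_mem (hsnd j hjb) (hsnd j₀ hjb₀))
      simpa using this
    rintro ⟨v, w⟩ hvw
    rw [LinearMap.mem_ker, coordSums_apply, Prod.mk_eq_zero] at hvw
    have hsum := add_mem
      (Submodule.sum_mem _ fun i (_ : i ∈ Finset.univ) => Submodule.smul_mem _ (v i) (hfst i))
      (Submodule.sum_mem _ fun j (_ : j ∈ Finset.univ) =>
        Submodule.smul_mem _ (w j) (hsnd j j.2))
    convert hsum using 1
    refine Prod.ext ?_ ?_
    · simpa [Prod.fst_sum] using (sum_smul_single_sub_single v hvw.1).symm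
    · simpa [Prod.snd_sum] using (sum_smul_single_sub_single w hvw.2).symm

/-- For every `U`-tree `T`, the family of points
`{(e_i, e_j) : (i,j) ∈ T} ⊆ ℝ^{a+1} × ℝ^{b+1}` is affinely independent; hence its convex
hull is a simplex of dimension `a + b`. -/
theorem utree_affine_independent (a b : ℕ) (u : ℕ → ℕ) (hu : IsUnimodular a u)
    (hub : ∀ i, i ≤ a → u i ≤ b + 1) (hmax : ∃ i, i ≤ a ∧ u i = b + 1)
    (T : Set (ℕ × ℕ)) (hT : IsUTree (stackSet a u) T) :
    AffineIndependent ℝ (fun p : T => embedPt a b (p : ℕ × ℕ)) ∧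
      Module.finrank ℝ (affineSpan ℝ (embedPt a b '' T)).direction = a + b := by
  refine ⟨hT.affineIndependent_embedPt hu hub, ?_⟩
  rw [direction_affineSpan, hT.vectorSpan_embedPt hu hub hmax, finrank_ker_coordSums]
end

section
/- A height function h : U → ℝ is non-crossing if and only if for every U-tree T there exist x ∈ ℝ^{a+1} and y ∈ ℝ^{b+1} such that x_i + y_j = h(i,j) for all (i,j) ∈ T and x_i + y_j > h(i,j) for all (i,j) ∈ U ∖ T. (This says that the regular subdivision of conv{(e_i,e_j) : (i,j) ∈ U} induced by the lift h has every U-tree as a cell exactly when h is non-crossing.) -/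
/-- A height function `h` on `U` is non-crossing if for every rectangle with its four
corners in `U`, the sum of the heights of the upper-left and lower-right corners is
strictly bigger than the sum of the heights of the lower-left and upper-right corners. -/
def NonCrossing (U : Set (ℕ × ℕ)) (h : ℕ × ℕ → ℝ) : Prop :=
  ∀ i i' j j' : ℕ, i < i' → j < j' → (i, j) ∈ U → (i, j') ∈ U → (i', j) ∈ U →
    (i', j') ∈ U → h (i, j') + h (i', j) < h (i, j) + h (i', j')

/-- If three corners of a rectangle (all but the upper-left one) in a finite set `U` force the
fourth into `U`, then every maximal family of points without crossings in `U` is cut out by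
potentials `x`, `y` dominating a non-crossing height function. -/
theorem exists_potentials_of_maximal (h : ℕ × ℕ → ℝ) (U : Finset (ℕ × ℕ)) :
    ∀ T : Set (ℕ × ℕ),
      (∀ i i' j j', i < i' → j < j' → (i, j') ∈ U → (i', j) ∈ U → (i', j') ∈ U → (i, j) ∈ U) →
      NonCrossing (U : Set (ℕ × ℕ)) h →
      T ⊆ U →
      (∀ i i' j j', i < i' → j < j' → (i, j') ∈ T → (i', j) ∈ T → (i', j') ∉ U) →
      (∀ i j, (i, j) ∈ U → (i, j) ∉ T →
        (∃ i' j', i < i' ∧ j' < j ∧ (i', j') ∈ T ∧ (i', j) ∈ U) ∨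
        (∃ i' j', i' < i ∧ j < j' ∧ (i', j') ∈ T ∧ (i, j') ∈ U)) →
      ∃ x y : ℕ → ℝ, (∀ i j, (i, j) ∈ T → x i + y j = h (i, j)) ∧
        ∀ i j, (i, j) ∈ U → (i, j) ∉ T → h (i, j) < x i + y j := by
  induction U using Finset.strongInduction with
  | H U ih =>
  intro T hcorner hnc hTU hcompat hmax
  rcases U.eq_empty_or_nonempty with rfl | hne
  · refine ⟨0, 0, fun i j hij => ?_, fun i j hij => ?_⟩
    · simpa using hTU hij
    · simp at hij
  -- `r` is the last column of the last row `b`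
  obtain ⟨⟨c₀, b⟩, hc₀, hb⟩ := U.exists_max_image Prod.snd hne
  have hb : ∀ i j, (i, j) ∈ U → j ≤ b := fun i j hij => hb _ hij
  obtain ⟨⟨r, b'⟩, hr', hr⟩ := (U.filter fun p => p.2 = b).exists_max_image Prod.fst
    ⟨(c₀, b), by simp [hc₀]⟩
  obtain ⟨hrU, rfl⟩ : (r, b') ∈ U ∧ b' = b := by simpa using hr'
  have hr : ∀ i, (i, b') ∈ U → i ≤ r := fun i hi => hr (i, b') (by simp [hi])
  have hrT : (r, b') ∈ T := by
    by_contra hn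
    rcases hmax _ _ hrU hn with ⟨i', j', h1, -, -, h4⟩ | ⟨i', j', -, h2, -, h4⟩
    · exact absurd (hr _ h4) (by omega)
    · exact absurd (hb _ _ h4) (by omega)
  by_cases hc : ∃ c, c < r ∧ (c, b') ∈ T
  · obtain ⟨c, hcr, hcT⟩ := hc
    have hcol : ∀ j, (r, j) ∈ T → j = b' := by
      intro j hj
      by_contra hne
      have := hb _ _ (hTU hj)
      exact hcompat c r j b' hcr (by omega) hcT hj hrU
    obtain ⟨x, y, hxy, hlt⟩ := ih (U.filter fun p => p.1 ≠ r)
      (Finset.filter_ssubset.2 ⟨_, hrU, by simp⟩) {p | p ∈ T ∧ p.1 ≠ r}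
      (by
        intro i i' j j' hi hj h1 h2 h3
        simp only [Finset.mem_filter] at *
        exact ⟨hcorner i i' j j' hi hj h1.1 h2.1 h3.1, h1.2⟩)
      (by
        intro i i' j j' hi hj h1 h2 h3 h4
        simp only [Finset.coe_filter, Set.mem_ofPred_eq] at h1 h2 h3 h4
        exact hnc i i' j j' hi hj h1.1 h2.1 h3.1 h4.1)
      (fun p hp => by simpa using ⟨hTU hp.1, hp.2⟩)
      (by
        intro i i' j j' hi hj h1 h2 h3
        exact hcompat i i' j j' hi hj h1.1 h2.1 (Finset.mem_filter.1 h3).1)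
      (by
        intro i j hij hn
        simp only [Finset.mem_filter, Set.mem_ofPred_eq] at hij hn ⊢
        rcases hmax i j hij.1 fun hT => hn ⟨hT, hij.2⟩ with
          ⟨i', j', h1, h2, h3, h4⟩ | ⟨i', j', h1, h2, h3, h4⟩
        · have hi' : i' ≠ r := by
            rintro rfl
            have := hcol _ h3
            have := hb _ _ hij.1
            omega
          exact .inl ⟨i', j', h1, h2, ⟨h3, hi'⟩, h4, hi'⟩
        · have hi' : i' ≠ r := by
            rintro rfl
            obtain rfl := hcol _ h3
            have := hr _ h4
            omega
          exact .inr ⟨i', j', h1, h2, ⟨h3, hi'⟩, h4, hij.2⟩)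
    have hle : ∀ i j, i ≠ r → (i, j) ∈ U → h (i, j) ≤ x i + y j := by
      intro i j hi hij
      by_cases hT : (i, j) ∈ T
      · exact (hxy i j ⟨hT, hi⟩).ge
      · exact (hlt i j (by simp [hij, hi]) fun hT' => hT hT'.1).le
    refine ⟨Function.update x r (h (r, b') - y b'), y, fun i j hij => ?_, fun i j hij hn => ?_⟩
    · by_cases hi : i = r
      · subst hi
        obtain rfl := hcol _ hij
        simp
      · simpa [hi] using hxy i j ⟨hij, hi⟩
    · by_cases hi : i = r
      · subst hi
        have hjb : j < b' := by
          refine lt_of_le_of_ne (hb _ _ hij) ?_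
          rintro rfl
          exact hn hrT
        have hcj := hcorner c i j b' hcr hjb (hTU hcT) hij hrU
        have h1 := hxy c b' ⟨hcT, hcr.ne⟩
        have h2 := hle c j hcr.ne hcj
        have h3 := hnc c i j b' hcr hjb hcj (hTU hcT) hij hrU
        simp only [Function.update_self]
        linarith
      · simpa [hi] using hlt i j (by simp [hij, hi]) fun hT => hn hT.1
  · have hrow : ∀ i, (i, b') ∈ T → i = r := by
      intro i hi
      by_contra hne
      have := hr _ (hTU hi)
      exact hc ⟨i, by omega, hi⟩
    obtain ⟨x, y, hxy, hlt⟩ := ih (U.filter fun p => p.2 ≠ b')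
      (Finset.filter_ssubset.2 ⟨_, hrU, by simp⟩) {p | p ∈ T ∧ p.2 ≠ b'}
      (by
        intro i i' j j' hi hj h1 h2 h3
        simp only [Finset.mem_filter] at *
        exact ⟨hcorner i i' j j' hi hj h1.1 h2.1 h3.1, h2.2⟩)
      (by
        intro i i' j j' hi hj h1 h2 h3 h4
        simp only [Finset.coe_filter, Set.mem_ofPred_eq] at h1 h2 h3 h4
        exact hnc i i' j j' hi hj h1.1 h2.1 h3.1 h4.1)
      (fun p hp => by simpa using ⟨hTU hp.1, hp.2⟩)
      (by
        intro i i' j j' hi hj h1 h2 h3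
        exact hcompat i i' j j' hi hj h1.1 h2.1 (Finset.mem_filter.1 h3).1)
      (by
        intro i j hij hn
        simp only [Finset.mem_filter, Set.mem_ofPred_eq] at hij hn ⊢
        rcases hmax i j hij.1 fun hT => hn ⟨hT, hij.2⟩ with
          ⟨i', j', h1, h2, h3, h4⟩ | ⟨i', j', h1, h2, h3, h4⟩
        · have := hb _ _ hij.1
          exact .inl ⟨i', j', h1, h2, ⟨h3, by omega⟩, h4, hij.2⟩
        · have hj' : j' ≠ b' := by
            rintro rfl
            have := hrow _ h3
            have := hr _ h4
            omega
          exact .inr ⟨i', j', h1, h2, ⟨h3, hj'⟩, h4, hj'⟩)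
    have hle : ∀ i j, j ≠ b' → (i, j) ∈ U → h (i, j) ≤ x i + y j := by
      intro i j hj hij
      by_cases hT : (i, j) ∈ T
      · exact (hxy i j ⟨hT, hj⟩).ge
      · exact (hlt i j (by simp [hij, hj]) fun hT' => hT hT'.1).le
    have hlast : ∀ n i, r - i = n → (i, b') ∈ U → i ≠ r →
        h (i, b') < x i + (h (r, b') - x r) := by
      intro n
      induction n using Nat.strong_induction_on with
      | _ n ihn =>
      intro i hn hi hir
      rcases hmax i b' hi fun hT => hir (hrow i hT) with
        ⟨i', j', h1, h2, h3, h4⟩ | ⟨i', j', -, h2, -, h4⟩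
      · have hi'r := hr _ h4
        have hij' := hcorner i i' j' b' h1 h2 hi (hTU h3) h4
        have e1 := hxy i' j' ⟨h3, h2.ne⟩
        have e2 := hle i j' h2.ne hij'
        have e3 := hnc i i' j' b' h1 h2 hij' hi (hTU h3) h4
        by_cases hr' : i' = r
        · subst hr'
          linarith
        · have := ihn (r - i') (by omega) i' rfl h4 hr'
          linarith
      · exact absurd (hb _ _ h4) (by omega)
    refine ⟨x, Function.update y b' (h (r, b') - x r), fun i j hij => ?_, fun i j hij hn => ?_⟩
    · by_cases hj : j = b'
      · subst hj
        obtain rfl := hrow _ hij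
        simp
      · simpa [hj] using hxy i j ⟨hij, hj⟩
    · by_cases hj : j = b'
      · subst hj
        have hir : i ≠ r := by
          rintro rfl
          exact hn hrT
        simpa using hlast _ i rfl hij hir
      · simpa [hj] using hlt i j (by simp [hij, hj]) fun hT => hn hT.1

theorem IsUnimodular.min_le {a : ℕ} {u : ℕ → ℕ} (hu : IsUnimodular a u) {i k i' : ℕ}
    (hik : i ≤ k) (hki' : k ≤ i') (hi' : i' ≤ a) : min (u i) (u i') ≤ u k := by
  obtain ⟨-, m, -, hinc, hdec⟩ := hu
  rcases le_total k m with hkm | hmk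
  · exact (min_le_left _ _).trans (hinc i k hik hkm)
  · exact (min_le_right _ _).trans (hdec k i' hmk hki' hi')

/-- In a stack set, a southwest-northeast pair of points is incompatible as soon as the
lower-right corner of the spanned rectangle lies in the set. -/
theorem IsUnimodular.incompat_of_corner {a : ℕ} {u : ℕ → ℕ} (hu : IsUnimodular a u)
    {i i' j j' : ℕ} (hi : i < i') (hj : j < j') (hij' : (i, j') ∈ stackSet a u)
    (hi'j' : (i', j') ∈ stackSet a u) : Incompat (stackSet a u) (i, j') (i', j) := by
  refine ⟨.inl ⟨hi, hj⟩, fun k l hk hk' hl hl' => ?_⟩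
  simp only [stackSet, Set.mem_ofPred_eq] at *
  have := hu.min_le (i := i) (k := k) (i' := i') (by omega) (by omega) hi'j'.1
  omega

theorem Incompat.exists_corner {U : Set (ℕ × ℕ)} {i j i' j' : ℕ}
    (h : Incompat U (i, j) (i', j')) :
    (i < i' ∧ j' < j ∧ (i', j) ∈ U) ∨ (i' < i ∧ j < j' ∧ (i, j') ∈ U) := by
  obtain ⟨⟨h1, h2⟩ | ⟨h1, h2⟩, hrect⟩ := h <;> simp only at h1 h2 hrect
  · exact .inl ⟨h1, h2, hrect _ _ (by omega) (by omega) (by omega) (by omega)⟩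
  · exact .inr ⟨h1, h2, hrect _ _ (by omega) (by omega) (by omega) (by omega)⟩

theorem stackSet_finite (a : ℕ) (u : ℕ → ℕ) : (stackSet a u).Finite := by
  refine ((Finset.range (a + 1)).sigma fun i => Finset.range (u i)).finite_toSet.image
    (fun s => (s.1, s.2)) |>.subset ?_
  rintro ⟨i, j⟩ ⟨hi, hj⟩
  exact ⟨⟨i, j⟩, by simpa using ⟨hi, hj⟩, rfl⟩

/-- Every pairwise compatible subset of a finite set extends to a `U`-tree. -/
theorem exists_isUTree_superset {U S : Set (ℕ × ℕ)} (hU : U.Finite) (hS : S ⊆ U)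
    (hc : S.Pairwise (Compat U)) : ∃ T, IsUTree U T ∧ S ⊆ T := by
  have hfin : {T : Set (ℕ × ℕ) | T ⊆ U ∧ T.Pairwise (Compat U)}.Finite :=
    hU.finite_subsets.subset fun T hT => hT.1
  obtain ⟨T, hST, hT⟩ := hfin.exists_le_maximal (a := S) ⟨hS, hc⟩
  exact ⟨T, ⟨hT.prop.1, hT.prop.2, fun T' h1 h2 h3 => (hT.eq_of_le ⟨h1, h2⟩ h3).symm⟩, hST⟩

theorem IsUTree.exists_incompat {U T : Set (ℕ × ℕ)} (hT : IsUTree U T) {p : ℕ × ℕ} (hp : p ∈ U)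
    (hpT : p ∉ T) : ∃ q ∈ T, Incompat U p q := by
  by_contra! hn
  refine hpT ?_
  rw [← hT.2.2 (insert p T) (Set.insert_subset hp hT.1) ?_ (Set.subset_insert p T)]
  · exact Set.mem_insert p T
  · exact hT.2.1.insert fun q hq _ => ⟨hn q hq, fun hqp => hn q hq hqp.symm⟩

/-- A height function `h : U → ℝ` is non-crossing if and only if for
every `U`-tree `T` there exist `x ∈ ℝ^{a+1}` and `y ∈ ℝ^{b+1}` such that
`x_i + y_j = h(i,j)` for all `(i,j) ∈ T` and `x_i + y_j > h(i,j)` for all `(i,j) ∈ U \ T`: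
every `U`-tree is a cell of the regular subdivision induced by the lift `h`. -/
theorem noncrossing_iff_utrees_are_cells (a b : ℕ) (u : ℕ → ℕ) (hu : IsUnimodular a u)
    (hub : ∀ i, i ≤ a → u i ≤ b + 1) (hmax : ∃ i, i ≤ a ∧ u i = b + 1)
    (h : ℕ × ℕ → ℝ) :
    NonCrossing (stackSet a u) h ↔
      ∀ T : Set (ℕ × ℕ), IsUTree (stackSet a u) T →
        ∃ (x : Fin (a + 1) → ℝ) (y : Fin (b + 1) → ℝ),
          (∀ (i : Fin (a + 1)) (j : Fin (b + 1)),
            ((i : ℕ), (j : ℕ)) ∈ T → x i + y j = h ((i : ℕ), (j : ℕ))) ∧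
          (∀ (i : Fin (a + 1)) (j : Fin (b + 1)),
            ((i : ℕ), (j : ℕ)) ∈ stackSet a u \ T →
              h ((i : ℕ), (j : ℕ)) < x i + y j) := by
  constructor
  · intro hnc T hT
    have hfin := stackSet_finite a u
    have hmem : ∀ p, p ∈ hfin.toFinset ↔ p ∈ stackSet a u := fun p => hfin.mem_toFinset
    obtain ⟨x, y, hxy, hlt⟩ := exists_potentials_of_maximal h hfin.toFinset T
      (by
        intro i i' j j' hi hj h1 h2 h3
        rw [hmem] at *
        exact ⟨h1.1, hj.trans h1.2⟩)
      (by simpa using hnc)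
      (by simpa using hT.1)
      (by
        intro i i' j j' hi hj h1 h2 h3
        rw [hmem] at h3
        exact hT.2.1 h1 h2 (by simp [hi.ne])
          (hu.incompat_of_corner hi hj (hT.1 h1) h3))
      (by
        intro i j hij hn
        simp only [hmem] at *
        obtain ⟨⟨i', j'⟩, hq, hinc⟩ := hT.exists_incompat hij hn
        rcases hinc.exists_corner with ⟨h1, h2, h3⟩ | ⟨h1, h2, h3⟩
        · exact .inl ⟨i', j', h1, h2, hq, h3⟩
        · exact .inr ⟨i', j', h1, h2, hq, h3⟩)
    exact ⟨fun i => x i, fun j => y j, fun i j hij => hxy i j hij,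
      fun i j hij => hlt i j ((hmem _).2 hij.1) hij.2⟩
  · intro hcells i i' j j' hi hj h1 h2 h3 h4
    obtain ⟨T, hT, hST⟩ := exists_isUTree_superset (S := {(i, j), (i', j')})
      (stackSet_finite a u) (by simp [Set.insert_subset_iff, h1, h4])
      (by
        refine (Set.pairwise_singleton _ _).insert ?_
        rintro _ rfl -
        constructor <;> rintro ⟨hlt, -⟩ <;> simp only at hlt <;> omega)
    obtain ⟨x, y, hxy, hlt⟩ := hcells T hT
    have hi' : i' < a + 1 := Nat.lt_succ_of_le h4.1
    have hj' : j' < b + 1 := h4.2.trans_le (hub _ h4.1)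
    set I : Fin (a + 1) := ⟨i, hi.trans hi'⟩
    set I' : Fin (a + 1) := ⟨i', hi'⟩
    set J : Fin (b + 1) := ⟨j, hj.trans hj'⟩
    set J' : Fin (b + 1) := ⟨j', hj'⟩
    have e1 : x I + y J = h (i, j) := hxy I J (hST (by simp [I, J]))
    have e2 : x I' + y J' = h (i', j') := hxy I' J' (hST (by simp [I', J']))
    have l1 : (i, j') ∉ T → h (i, j') < x I + y J' := fun hn => hlt I J' ⟨h2, hn⟩
    have l2 : (i', j) ∉ T → h (i', j) < x I' + y J := fun hn => hlt I' J ⟨h3, hn⟩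
    by_cases hA : (i, j') ∈ T
    · have hB : (i', j) ∉ T := fun hB =>
        hT.2.1 hA hB (by simp [hi.ne]) (hu.incompat_of_corner hi hj h2 h4)
      have e3 : x I + y J' = h (i, j') := hxy I J' hA
      linarith [l2 hB]
    · have hle : h (i', j) ≤ x I' + y J := by
        by_cases hB : (i', j) ∈ T
        · exact (hxy I' J hB).ge
        · exact (l2 hB).le
      linarith [l1 hA]
end
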